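/- There exists a universal constant c > 0 with the following property. Let p ∈ [1,2], let X be a finite-dimensional real normed space of dimension d ≥ 1 that has Rademacher type p with constant T, let n ≥ 1, and suppose f : {-1,1}^n → X satisfies s·ρ(x,y) ≤ ‖f(x) − f(y)‖_X ≤ s·D·ρ(x,y) for all x,y ∈ {-1,1}^n, for some s > 0 and D ≥ 1. Then D ≥ c · n / (T · min(n, d)^{1/p}). -/

import Mathlib

open Finset

noncomputable section

/-- The real sign of a Boolean coordinate: `true ↦ 1`, `false ↦ -1`. -/
def sgn (b : Bool) : ℝ := if b then 1 else -1

/-- Hamming distance on the discrete cube `{-1,1}^n ≃ Bool^n`. -/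
def hamming {n : ℕ} (x y : Fin n → Bool) : ℕ :=
  (Finset.univ.filter fun i => x i ≠ y i).card

/-- Flip the `i`-th coordinate. -/
def flipc {ι : Type*} [DecidableEq ι] (x : ι → Bool) (i : ι) : ι → Bool :=
  Function.update x i (!(x i))

/-- Negate all coordinates (the antipodal map). -/
def negc {ι : Type*} (x : ι → Bool) : ι → Bool := fun i => !(x i)

/-- `X` has Rademacher type `p` with constant `T`. -/
def RademacherType (X : Type*) [NormedAddCommGroup X] [NormedSpace ℝ X] (p T : ℝ) : Prop :=
  ∀ (m : ℕ) (v : Fin m → X),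
    (2 ^ m : ℝ)⁻¹ * ∑ x : Fin m → Bool, ‖∑ i, sgn (x i) • v i‖ ^ p ≤
      T ^ p * ∑ i, ‖v i‖ ^ p

/-- `X` has cotype `q` with constant `Cq`. -/
def CotypeC (X : Type*) [NormedAddCommGroup X] [NormedSpace ℝ X] (q Cq : ℝ) : Prop :=
  ∀ (m : ℕ) (v : Fin m → X),
    (∑ i, ‖v i‖ ^ q) / Cq ^ q ≤
      (2 ^ m : ℝ)⁻¹ * ∑ x : Fin m → Bool, ‖∑ i, sgn (x i) • v i‖ ^ q

open scoped Classical in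
/-- The weak `ℓ_p` norm of a finite real vector. -/
def weakLp {ι : Type*} [Fintype ι] (p : ℝ) (w : ι → ℝ) : ℝ :=
  sSup {z | ∃ r : ℝ, 0 ≤ r ∧
    z = r * ((Finset.univ.filter fun i => r ≤ |w i|).card : ℝ) ^ (1 / p)}

/-- Metric stable type `p` with constant `S`. -/
def MetricStableType (M : Type*) [PseudoMetricSpace M] (p S : ℝ) : Prop :=
  ∀ (n : ℕ) (f : (Fin n → Bool) → M),
    (2 ^ n : ℝ)⁻¹ * ∑ x : Fin n → Bool, dist (f x) (f (negc x)) ^ p ≤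
      S ^ p * ((2 ^ n : ℝ)⁻¹ *
        ∑ x : Fin n → Bool, weakLp p (fun i => (1 / 2) * dist (f x) (f (flipc x i))) ^ p)

/-- The product biased measure weight of a point of the cube. -/
def biasedWeight {ι : Type*} [Fintype ι] (α : ι → ℝ) (x : ι → Bool) : ℝ :=
  ∏ i, if x i then α i else 1 - α i

/-- The biased discrete partial derivative `∂_i^α`. -/
def bder {ι : Type*} [DecidableEq ι] {X : Type*} [AddCommGroup X] [Module ℝ X]
    (α : ℝ) (i : ι) (f : (ι → Bool) → X) (x : ι → Bool) : X :=
  f x - (α • f (Function.update x i true) + (1 - α) • f (Function.update x i false))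

/-- The `L_p(μ; X)` norm with respect to the weight `μ` on the cube. -/
def lpNormW {ι : Type*} [Fintype ι] [DecidableEq ι] {X : Type*} [NormedAddCommGroup X]
    (μ : (ι → Bool) → ℝ) (p : ℝ) (g : (ι → Bool) → X) : ℝ :=
  (∑ x : ι → Bool, μ x * ‖g x‖ ^ p) ^ (1 / p)

/-- The Orlicz `L_p(log L)^{p/2}(μ; X)` norm with respect to the weight `μ` on the cube. -/
def orliczNormW {ι : Type*} [Fintype ι] [DecidableEq ι] {X : Type*} [NormedAddCommGroup X]
    (μ : (ι → Bool) → ℝ) (p : ℝ) (g : (ι → Bool) → X) : ℝ :=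
  sInf {γ : ℝ | 0 < γ ∧
    ∑ x : ι → Bool, (μ x * (‖g x‖ ^ p / γ ^ p)) *
      Real.log (Real.exp 1 + ‖g x‖ ^ p / γ ^ p) ^ (p / 2) ≤ 1}

/-- The one-dimensional transition kernel `p_t^α`. -/
def ptrans (t α : ℝ) : Bool → Bool → ℝ := fun a b =>
  match a, b with
  | true, true => 1 - (1 - Real.exp (-t)) * (1 - α)
  | true, false => (1 - Real.exp (-t)) * (1 - α)
  | false, true => (1 - Real.exp (-t)) * α
  | false, false => 1 - (1 - Real.exp (-t)) * α

/-- The matrix `η_t^α(·,·;θ)`. -/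
def eta (t α θ : ℝ) : Bool → Bool → ℝ := fun a b =>
  match a, b with
  | true, true => (Real.exp (-t) - θ) / ptrans t α true true
  | true, false => (-θ) / ptrans t α false true
  | false, true => (θ - Real.exp (-t)) / ptrans t α true false
  | false, false => θ / ptrans t α false false

/-- The product transition kernel `p_t^𝛂`. -/
def pprod {n : ℕ} (t : ℝ) (α : Fin n → ℝ) (x y : Fin n → Bool) : ℝ :=
  ∏ i, ptrans t (α i) (x i) (y i)

/-- Glue coordinates on `σ` (given by `x`) with coordinates off `σ` (given by `w`). -/
def glue {n : ℕ} (σ : Finset (Fin n)) (x : {i // i ∈ σ} → Bool) (w : Fin n → Bool) :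
    Fin n → Bool := fun j => if h : j ∈ σ then x ⟨j, h⟩ else w j

/-- The low-dimensional skeleton `𝒞_d^n` of the solid cube `[-1,1]^n`. -/
def cubeSkeleton (n d : ℕ) : Set (Fin n → ℝ) :=
  {x | (∀ i, |x i| ≤ 1) ∧ n - d ≤ {i | |x i| = 1}.ncard}

/-- The `ℓ_p^d` norm on `ℝ^d`. -/
def lpnorm (p : ℝ) {d : ℕ} (v : Fin d → ℝ) : ℝ := (∑ k, |v k| ^ p) ^ (1 / p)

/-- The indicator, with values in `ZMod 2`, that the nonzero entries of a sign vector alternate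
and that the first of them is `b`. -/
def altCoeff : (n : ℕ) → SignType → (Fin n → SignType) → ZMod 2
  | 0, _, _ => 1
  | n + 1, b, c =>
    if c 0 = 0 then altCoeff n b (Fin.tail c)
    else if c 0 = b then altCoeff n (-b) (Fin.tail c) else 0

lemma altCoeff_neg (n : ℕ) (b : SignType) (c : Fin n → SignType) :
    altCoeff n b (-c) = altCoeff n (-b) c := by
  induction n generalizing b with
  | zero => rfl
  | succ n ih =>
    have ht : Fin.tail (-c) = -Fin.tail c := rfl
    simp only [altCoeff, ht, ih, Pi.neg_apply, SignType.neg_eq_zero_iff]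
    congr 1
    have : (-c 0 = b) ↔ (c 0 = -b) := neg_eq_iff_eq_neg
    simp only [this]

lemma zmod_two_add_self (a : ZMod 2) : a + a = 0 := CharTwo.add_self_eq_zero a

lemma sum_altCoeff_update_zero (n : ℕ) (b : SignType) (hb : b ≠ 0) (c : Fin n → SignType) :
    ∑ i, (if c i = 0 then 0 else altCoeff n b (Function.update c i 0)) =
      altCoeff n b c + altCoeff n (-b) c := by
  induction n generalizing b with
  | zero => simp [altCoeff, zmod_two_add_self]
  | succ n ih =>
    have hb' : -b ≠ 0 := by simpa using hb
    have h1 : ∀ i : Fin n, Fin.tail (Function.update c i.succ 0) =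
        Function.update (Fin.tail c) i 0 := fun i => Fin.tail_update_succ ..
    have h2 : Fin.tail (Function.update c 0 0) = Fin.tail c := Fin.tail_update_zero ..
    have h3 : ∀ i : Fin n, Function.update c i.succ 0 0 = c 0 := fun i =>
      Function.update_of_ne (Fin.succ_ne_zero i).symm ..
    have h4 : ∀ i : Fin n, c i.succ = Fin.tail c i := fun i => rfl
    rw [Fin.sum_univ_succ]
    simp only [altCoeff, h1, h2, h3, h4, Function.update_self, if_true, neg_neg]
    by_cases hc : c 0 = 0
    · simp only [hc, if_true, zero_add]
      exact ih b hb _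
    · by_cases hcb : c 0 = b
      · have hne : ¬ (c 0 = -b) := by
          rw [hcb]; clear hcb hb' ih; revert b; decide
        simp only [hcb, hb, if_true, if_false]
        have := ih (-b) hb' (Fin.tail c)
        rw [neg_neg] at this
        rw [this]
        have hbb : ¬ (b = -b) := hcb ▸ hne
        simp only [hbb, if_false]
        linear_combination zmod_two_add_self (altCoeff n b (Fin.tail c))
      · have hcb' : c 0 = -b := by
          revert hc hcb hb; generalize c 0 = x; clear hb' ih; revert x b; decide
        have : ¬ (-b = b) := hcb' ▸ hcb
        simp [hcb', hb, this]

/-- The sum of `F` over the two neighbours of `v` in direction `j` when `v j` is even, and `0`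
when `v j` is odd. -/
def nbrSum {n : ℕ} (j : Fin n) (F : (Fin n → ℤ) → ZMod 2) (v : Fin n → ℤ) : ZMod 2 :=
  if Even (v j) then F (Function.update v j (v j + 1)) + F (Function.update v j (v j - 1)) else 0

lemma nbrSum_comm {n : ℕ} {j l : Fin n} (h : j ≠ l) (F : (Fin n → ℤ) → ZMod 2) :
    nbrSum j (nbrSum l F) = nbrSum l (nbrSum j F) := by
  funext v
  unfold nbrSum
  simp only [Function.update_of_ne h, Function.update_of_ne h.symm]
  by_cases hj : Even (v j) <;> by_cases hl : Even (v l) <;> simp only [hj, hl, if_true, if_false]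
  · simp only [Function.update_comm h]
    ring
  · simp
  · simp

lemma nbrSum_sum {n : ℕ} {ι : Type*} (s : Finset ι) (j : Fin n)
    (F : ι → (Fin n → ℤ) → ZMod 2) (v : Fin n → ℤ) :
    nbrSum j (fun u => ∑ l ∈ s, F l u) v = ∑ l ∈ s, nbrSum j (F l) v := by
  unfold nbrSum
  split_ifs
  · rw [Finset.sum_add_distrib]
  · simp

lemma sum_sum_erase_symm {ι : Type*} [DecidableEq ι] (A : Finset ι) (f : ι → ι → ZMod 2)
    (hf : ∀ i j, i ≠ j → f i j = f j i) : ∑ i ∈ A, ∑ j ∈ A.erase i, f i j = 0 := by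
  rw [Finset.sum_sigma']
  refine Finset.sum_involution (fun x _ => ⟨x.2, x.1⟩) ?_ ?_ ?_ ?_
  · rintro ⟨i, j⟩ h
    simp only [Finset.mem_sigma, Finset.mem_erase] at h
    dsimp only
    rw [hf i j h.2.1.symm]
    exact zmod_two_add_self _
  · rintro ⟨i, j⟩ h - h'
    simp only [Finset.mem_sigma, Finset.mem_erase] at h
    exact h.2.1 (by simpa using (congrArg Sigma.fst h'))
  · rintro ⟨i, j⟩ h
    simp only [Finset.mem_sigma, Finset.mem_erase] at h ⊢
    exact ⟨h.2.2, h.2.1.symm, h.1⟩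
  · rintro ⟨i, j⟩ h
    rfl

/-- The cup product of the coboundaries of `e (k - 1), …, e 0`, summed over the lattice paths
that start at the given vertex and use directions from `A`, each at most once. -/
def pathSum {n : ℕ} (e : ℕ → (Fin n → ℤ) → ZMod 2) :
    ℕ → Finset (Fin n) → (Fin n → ℤ) → ZMod 2
  | 0, _, _ => 1
  | k + 1, A, v => ∑ j ∈ A, nbrSum j (fun u => e k u * pathSum e k (A.erase j) u) v

lemma sum_nbrSum_pathSum {n : ℕ} (e : ℕ → (Fin n → ℤ) → ZMod 2) (k : ℕ) (A : Finset (Fin n))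
    (v : Fin n → ℤ) : ∑ j ∈ A, nbrSum j (pathSum e k (A.erase j)) v = 0 := by
  cases k with
  | zero =>
    refine Finset.sum_eq_zero fun j _ => ?_
    unfold nbrSum pathSum
    split_ifs
    · exact zmod_two_add_self _
    · rfl
  | succ k =>
    have : ∀ j, nbrSum j (pathSum e (k + 1) (A.erase j)) v =
        ∑ l ∈ A.erase j, nbrSum j (nbrSum l
          (fun u => e k u * pathSum e k ((A.erase j).erase l) u)) v := fun j => by
      rw [← nbrSum_sum]; rfl
    simp only [this]
    refine sum_sum_erase_symm A (fun j l => nbrSum j (nbrSum l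
          (fun u => e k u * pathSum e k ((A.erase j).erase l) u)) v) fun i j hij => ?_
    rw [nbrSum_comm hij, Finset.erase_right_comm]

lemma pathSum_succ {n : ℕ} (e : ℕ → (Fin n → ℤ) → ZMod 2) (k : ℕ) (A : Finset (Fin n))
    (v : Fin n → ℤ) : pathSum e (k + 1) A v =
      ∑ j ∈ A, nbrSum j (fun u => (e k u + e k v) * pathSum e k (A.erase j) u) v := by
  have h : ∀ j, nbrSum j (fun u => (e k u + e k v) * pathSum e k (A.erase j) u) v =
      nbrSum j (fun u => e k u * pathSum e k (A.erase j) u) v +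
        e k v * nbrSum j (pathSum e k (A.erase j)) v := fun j => by
    unfold nbrSum
    split_ifs <;> ring
  simp only [h]
  rw [Finset.sum_add_distrib, ← Finset.mul_sum, sum_nbrSum_pathSum, mul_zero, add_zero]
  rfl

lemma pathSum_neg {n : ℕ} (e : ℕ → (Fin n → ℤ) → ZMod 2)
    (he : ∀ k v, v ≠ 0 → e k (-v) = e k v + 1) (k : ℕ) (A : Finset (Fin n))
    (v : Fin n → ℤ) (hv : ∃ i ∉ A, v i ≠ 0) : pathSum e k A (-v) = pathSum e k A v := by
  induction k generalizing A v with
  | zero => rfl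
  | succ k ih =>
    rw [pathSum_succ, pathSum_succ]
    refine Finset.sum_congr rfl fun j hj => ?_
    obtain ⟨i, hiA, hi⟩ := hv
    have hij : i ≠ j := fun h => hiA (h ▸ hj)
    have key : ∀ t : ℤ, (e k (Function.update (-v) j (-t)) + e k (-v)) *
        pathSum e k (A.erase j) (Function.update (-v) j (-t)) =
        (e k (Function.update v j t) + e k v) *
        pathSum e k (A.erase j) (Function.update v j t) := fun t => by
      have h1 : Function.update (-v) j (-t) = -Function.update v j t := by
        funext x
        by_cases hx : x = j
        · subst hx; simp
        · simp [hx]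
      have h2 : Function.update v j t i = v i := Function.update_of_ne hij ..
      rw [h1, ih _ _ ⟨i, fun h => hiA (Finset.mem_of_mem_erase h), h2.symm ▸ hi⟩,
        he k _ (fun h => hi (by rw [← h2, h]; rfl)), he k v (fun h => hi (by rw [h]; rfl))]
      linear_combination (pathSum e k (A.erase j) (Function.update v j t)) *
        zmod_two_add_self 1
    unfold nbrSum
    simp only [Pi.neg_apply, even_neg]
    split_ifs
    · rw [← key, ← key, add_comm]
      congr 3 <;> ring_nf
    · rfl

lemma exists_ne_of_pathSum_ne_zero {n : ℕ} (e : ℕ → (Fin n → ℤ) → ZMod 2) (k : ℕ)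
    (A : Finset (Fin n)) (v : Fin n → ℤ) (h : pathSum e k A v ≠ 0) :
    ∀ i < k, ∃ u w : Fin n → ℤ, (∀ x, |u x - v x| ≤ 1) ∧ (∀ x, |w x - v x| ≤ 1) ∧
      e i u ≠ e i w := by
  have main : ∀ i < k, ∃ u w : Fin n → ℤ, (∀ x, |u x - v x| ≤ if x ∈ A then 1 else 0) ∧
      (∀ x, |w x - v x| ≤ if x ∈ A then 1 else 0) ∧ e i u ≠ e i w := by
    induction k generalizing A v with
    | zero => intro i hi; omega
    | succ k ih =>
      rw [pathSum_succ] at h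
      obtain ⟨j, hj, hne⟩ := Finset.exists_ne_zero_of_sum_ne_zero h
      have : ∃ t : ℤ, |t - v j| ≤ 1 ∧ (e k (Function.update v j t) + e k v) *
          pathSum e k (A.erase j) (Function.update v j t) ≠ 0 := by
        unfold nbrSum at hne
        split_ifs at hne with hev
        · by_contra! hcon
          dsimp only at hne
          rw [hcon (v j + 1) (by simp), hcon (v j - 1) (by simp)] at hne
          exact hne (add_zero 0)
        · exact absurd rfl hne
      obtain ⟨t, ht, hprod⟩ := this
      have hstep : ∀ x, |Function.update v j t x - v x| ≤ if x = j then 1 else 0 := by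
        intro x
        by_cases hx : x = j
        · subst hx; simpa using ht
        · simp [hx]
      intro i hi
      rcases Nat.lt_succ_iff_lt_or_eq.mp hi with hik | rfl
      · obtain ⟨u, w, hu, hw, huw⟩ := ih _ _ (right_ne_zero_of_mul hprod) i hik
        have comb : ∀ y : Fin n → ℤ,
            (∀ x, |y x - Function.update v j t x| ≤ if x ∈ A.erase j then 1 else 0) →
            ∀ x, |y x - v x| ≤ if x ∈ A then 1 else 0 := by
          intro y hy x
          have h1 := hy x
          have h2 := hstep x
          have h3 := abs_sub_le (y x) (Function.update v j t x) (v x)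
          by_cases hx : x = j
          · subst hx
            simp only [Finset.mem_erase, ne_eq, not_true, false_and, if_false, if_true, hj]
              at h1 h2 ⊢
            omega
          · simp only [Finset.mem_erase, ne_eq, hx, not_false_eq_true, true_and, if_false]
              at h1 h2 ⊢
            omega
        exact ⟨u, w, comb u hu, comb w hw, huw⟩
      · refine ⟨Function.update v j t, v, ?_, ?_, fun heq => left_ne_zero_of_mul hprod ?_⟩
        · intro x
          refine (hstep x).trans ?_
          by_cases hx : x = j
          · subst hx; simp [hj]
          · simp only [hx, if_false]; split_ifs <;> simp
        · intro x; simp only [sub_self, abs_zero]; split_ifs <;> simp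
        · rw [heq]; exact zmod_two_add_self _
  intro i hi
  obtain ⟨u, w, hu, hw, huw⟩ := main i hi
  refine ⟨u, w, fun x => (hu x).trans ?_, fun x => (hw x).trans ?_, huw⟩ <;> split_ifs <;> simp

lemma sum_piFinset_update {n : ℕ} (B : Fin n → Finset ℤ) (j : Fin n) (I : Finset ℤ)
    (G : (Fin n → ℤ) → ZMod 2) :
    ∑ v ∈ Fintype.piFinset (Function.update B j I), G v =
      ∑ w ∈ Fintype.piFinset (Function.update B j {0}), ∑ t ∈ I, G (Function.update w j t) := by
  rw [← Finset.sum_product']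
  refine Finset.sum_nbij' (fun v => (Function.update v j 0, v j))
    (fun x => Function.update x.1 j x.2) ?_ ?_ ?_ ?_ ?_
  · intro v hv
    simp only [Fintype.mem_piFinset, Finset.mem_product] at hv ⊢
    refine ⟨fun i => ?_, by simpa using hv j⟩
    by_cases hi : i = j
    · subst hi; simp
    · simpa [hi] using hv i
  · rintro ⟨w, t⟩ hw
    simp only [Fintype.mem_piFinset, Finset.mem_product] at hw ⊢
    intro i
    by_cases hi : i = j
    · subst hi; simpa using hw.2
    · simpa [hi] using hw.1 i
  · intro v _; simp
  · rintro ⟨w, t⟩ hw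
    simp only [Fintype.mem_piFinset, Finset.mem_product] at hw
    have : w j = 0 := by simpa using hw.1 j
    simp [← this]
  · intro v _; simp

lemma sum_Icc_even_nbr (M : ℕ) (φ : ℤ → ZMod 2) :
    ∑ t ∈ Finset.Icc (-(2 * M + 1 : ℤ)) (2 * M + 1),
      (if Even t then φ (t + 1) + φ (t - 1) else 0) = φ (2 * M + 1) + φ (-(2 * M + 1)) := by
  induction M with
  | zero =>
    have : Finset.Icc (-(2 * (0 : ℕ) + 1 : ℤ)) (2 * (0 : ℕ) + 1) = {-1, 0, 1} := by decide
    rw [this]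
    simp
  | succ M ih =>
    have hI : Finset.Icc (-(2 * (M + 1 : ℕ) + 1 : ℤ)) (2 * (M + 1 : ℕ) + 1) =
        insert (2 * (M : ℤ) + 3) (insert (2 * (M : ℤ) + 2) (insert (-(2 * (M : ℤ) + 3))
          (insert (-(2 * (M : ℤ) + 2)) (Finset.Icc (-(2 * M + 1 : ℤ)) (2 * M + 1))))) := by
      ext t
      simp only [Finset.mem_insert, Finset.mem_Icc]
      push_cast
      omega
    have o1 : ¬ Even (2 * (M : ℤ) + 3) := by rw [Int.even_iff]; omega
    have o2 : Even (2 * (M : ℤ) + 2) := by rw [Int.even_iff]; omega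
    have o3 : ¬ Even (-(2 * (M : ℤ) + 3)) := by rwa [even_neg]
    have o4 : Even (-(2 * (M : ℤ) + 2)) := by rwa [even_neg]
    rw [hI, Finset.sum_insert (by simp; omega), Finset.sum_insert (by simp; omega),
      Finset.sum_insert (by simp), Finset.sum_insert (by simp), ih,
      if_neg o1, if_pos o2, if_neg o3, if_pos o4]
    push_cast
    rw [show 2 * (M : ℤ) + 2 + 1 = 2 * (M + 1) + 1 by ring,
      show 2 * (M : ℤ) + 2 - 1 = 2 * M + 1 by ring,
      show -(2 * (M : ℤ) + 2) + 1 = -(2 * M + 1) by ring,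
      show -(2 * (M : ℤ) + 2) - 1 = -(2 * (M + 1) + 1) by ring]
    linear_combination zmod_two_add_self (φ (2 * M + 1)) + zmod_two_add_self (φ (-(2 * M + 1)))

/-- The lattice points of the face of the cube `[-N, N]^n` encoded by the sign vector `c`, whose
zero entries are the free coordinates. -/
def latticeFace {n : ℕ} (N : ℤ) (c : Fin n → SignType) : Finset (Fin n → ℤ) :=
  Fintype.piFinset fun i => if c i = 0 then Finset.Icc (-N) N else {(c i : ℤ) * N}

/-- The free coordinates of a face. -/
def freeCoords {n : ℕ} (c : Fin n → SignType) : Finset (Fin n) := {i | c i = 0}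

lemma latticeFace_update {n : ℕ} (N : ℤ) (c : Fin n → SignType) (j : Fin n) (τ : SignType)
    (hτ : τ ≠ 0) : latticeFace N (Function.update c j τ) = Fintype.piFinset
      (Function.update (fun i => if c i = 0 then Finset.Icc (-N) N else {(c i : ℤ) * N}) j
        {(τ : ℤ) * N}) := by
  unfold latticeFace
  congr 1
  funext i
  by_cases hi : i = j
  · subst hi; simp [hτ]
  · simp [hi]

lemma sum_latticeFace_nbrSum {n : ℕ} (M : ℕ) (c : Fin n → SignType) (j : Fin n) (hj : c j = 0)
    (F : (Fin n → ℤ) → ZMod 2) :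
    ∑ v ∈ latticeFace (2 * M + 1) c, nbrSum j F v =
      ∑ v ∈ latticeFace (2 * M + 1) (Function.update c j 1), F v +
      ∑ v ∈ latticeFace (2 * M + 1) (Function.update c j (-1)), F v := by
  have h0 : latticeFace (2 * M + 1 : ℤ) c = Fintype.piFinset
      (Function.update (fun i => if c i = 0 then Finset.Icc (-(2 * M + 1 : ℤ)) (2 * M + 1)
        else {(c i : ℤ) * (2 * M + 1)}) j (Finset.Icc (-(2 * M + 1 : ℤ)) (2 * M + 1))) := by
    unfold latticeFace
    congr 1
    funext i
    by_cases hi : i = j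
    · subst hi; simp [hj]
    · simp [hi]
  rw [h0, latticeFace_update _ _ _ _ (by decide), latticeFace_update _ _ _ _ (by decide),
    sum_piFinset_update, sum_piFinset_update _ j {((1 : SignType) : ℤ) * (2 * M + 1)},
    sum_piFinset_update _ j {((-1 : SignType) : ℤ) * (2 * M + 1)}, ← Finset.sum_add_distrib]
  refine Finset.sum_congr rfl fun w _ => ?_
  have := sum_Icc_even_nbr M (fun t => F (Function.update w j t))
  simp only [nbrSum, Function.update_self, Function.update_idem, Finset.sum_singleton]
  simpa using this

lemma mem_latticeFace_neg {n : ℕ} {N : ℤ} {c : Fin n → SignType} {v : Fin n → ℤ}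
    (h : v ∈ latticeFace N c) : -v ∈ latticeFace N (-c) := by
  unfold latticeFace at *
  rw [Fintype.mem_piFinset] at *
  intro i
  have := h i
  by_cases hc : c i = 0
  · simp only [hc, Pi.neg_apply, if_true, Finset.mem_Icc, neg_zero] at this ⊢
    omega
  · simp only [hc, Pi.neg_apply, if_false, Finset.mem_singleton,
      SignType.neg_eq_zero_iff] at this ⊢
    rw [this]; simp

lemma sum_latticeFace_neg {n : ℕ} (N : ℤ) (c : Fin n → SignType) (F : (Fin n → ℤ) → ZMod 2) :
    ∑ v ∈ latticeFace N (-c), F v = ∑ v ∈ latticeFace N c, F (-v) := by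
  refine Finset.sum_nbij' (fun v => -v) (fun v => -v) ?_ ?_ ?_ ?_ ?_
  · intro v hv; simpa using mem_latticeFace_neg hv
  · intro v hv; exact mem_latticeFace_neg hv
  all_goals simp

lemma sum_altCoeff (n : ℕ) (b : SignType) (hb : b ≠ 0) :
    ∑ c : Fin n → SignType, (if freeCoords c = ∅ then altCoeff n b c else 0) = 1 := by
  have hfree : ∀ m (c : Fin m → SignType), freeCoords c = ∅ ↔ ∀ i, c i ≠ 0 := fun m c => by
    simp [freeCoords, Finset.filter_eq_empty_iff]
  simp only [hfree]
  induction n generalizing b with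
  | zero => simp [altCoeff]
  | succ n ih =>
    rw [← (Fin.consEquiv fun _ => SignType).sum_comp, Fintype.sum_prod_type]
    have h : ∀ (a : SignType) (c : Fin n → SignType),
        (if ∀ i, (Fin.consEquiv fun _ => SignType) (a, c) i ≠ 0 then
          altCoeff (n + 1) b ((Fin.consEquiv fun _ => SignType) (a, c)) else 0) =
        if a = b then (if ∀ i, c i ≠ 0 then altCoeff n (-b) c else 0) else 0 := fun a c => by
      have ht : Fin.tail ((Fin.consEquiv fun _ => SignType) (a, c)) = c := rfl
      have h0 : (Fin.consEquiv fun _ => SignType) (a, c) 0 = a := rfl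
      have hs : ∀ i : Fin n, (Fin.consEquiv fun _ => SignType) (a, c) i.succ = c i := fun i => rfl
      simp only [Fin.forall_fin_succ, altCoeff, ht, h0, hs]
      by_cases hab : a = b
      · subst hab; simp [hb]
      · by_cases ha : a = 0
        · simp [ha, hb.symm]
        · simp [hab, ha]
    simp only [h]
    rw [Finset.sum_eq_single b]
    · simpa using ih (-b) (by simpa using hb)
    · intro a _ hab; simp [hab]
    · simp

/-- The pairing of the cochain `pathSum` with the alternating `k`-dimensional hemisphere. -/
def hemiSum (n : ℕ) (e : ℕ → (Fin n → ℤ) → ZMod 2) (M k : ℕ) : ZMod 2 :=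
  ∑ c : Fin n → SignType with #(freeCoords c) = k,
    altCoeff n 1 c * ∑ v ∈ latticeFace (2 * M + 1) c, pathSum e k (freeCoords c) v

lemma hemiSum_zero (n : ℕ) (e : ℕ → (Fin n → ℤ) → ZMod 2) (M : ℕ) : hemiSum n e M 0 = 1 := by
  rw [← sum_altCoeff n 1 (by decide), hemiSum, Finset.sum_filter]
  refine Finset.sum_congr rfl fun c _ => ?_
  simp only [Finset.card_eq_zero]
  refine if_ctx_congr Iff.rfl (fun h => ?_) fun _ => rfl
  have h' : ∀ i, c i ≠ 0 := by simpa [freeCoords, Finset.filter_eq_empty_iff] using h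
  have hcard : #(latticeFace (2 * M + 1 : ℤ) c) = 1 := by
    rw [latticeFace, Fintype.card_piFinset]
    exact Finset.prod_eq_one fun i _ => by simp [h' i]
  simp [pathSum, hcard]

lemma freeCoords_update_zero {n : ℕ} (c : Fin n → SignType) (j : Fin n) :
    freeCoords (Function.update c j 0) = insert j (freeCoords c) := by
  ext i
  by_cases hi : i = j
  · subst hi; simp [freeCoords]
  · simp [freeCoords, hi]

lemma freeCoords_update_ne_zero {n : ℕ} (c : Fin n → SignType) (j : Fin n) {τ : SignType}
    (hτ : τ ≠ 0) : freeCoords (Function.update c j τ) = (freeCoords c).erase j := by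
  ext i
  by_cases hi : i = j
  · subst hi; simp [freeCoords, hτ]
  · simp [freeCoords, hi]

lemma freeCoords_neg {n : ℕ} (c : Fin n → SignType) : freeCoords (-c) = freeCoords c := by
  ext i
  simp [freeCoords, SignType.neg_eq_zero_iff]

lemma hemiSum_boundary (n : ℕ) (k : ℕ) (E : (Fin n → SignType) → ZMod 2) :
    ∑ c : Fin n → SignType with #(freeCoords c) = k + 1,
      altCoeff n 1 c * ∑ j ∈ freeCoords c,
        (E (Function.update c j 1) + E (Function.update c j (-1))) =
    ∑ c : Fin n → SignType with #(freeCoords c) = k,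
      (altCoeff n 1 c + altCoeff n (-1) c) * E c := by
  have h1 : ∀ c : Fin n → SignType, (altCoeff n 1 c + altCoeff n (-1) c) * E c =
      ∑ j with c j ≠ 0, altCoeff n 1 (Function.update c j 0) * E c := fun c => by
    rw [← sum_altCoeff_update_zero n 1 (by decide) c, Finset.sum_mul, Finset.sum_filter]
    refine Finset.sum_congr rfl fun j _ => ?_
    by_cases h : c j = 0 <;> simp [h]
  have h2 : ∀ c : Fin n → SignType, altCoeff n 1 c * ∑ j ∈ freeCoords c,
        (E (Function.update c j 1) + E (Function.update c j (-1))) =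
      ∑ x ∈ freeCoords c ×ˢ ({1, -1} : Finset SignType),
        altCoeff n 1 c * E (Function.update c x.1 x.2) := fun c => by
    rw [Finset.sum_product, Finset.mul_sum]
    refine Finset.sum_congr rfl fun j _ => ?_
    rw [Finset.sum_pair (by decide), mul_add]
  simp only [h1, h2]
  rw [Finset.sum_sigma', Finset.sum_sigma']
  have htau : ∀ τ : SignType, τ ∈ ({1, -1} : Finset SignType) ↔ τ ≠ 0 := by decide
  refine Finset.sum_nbij' (fun x => ⟨Function.update x.1 x.2.1 x.2.2, x.2.1⟩)
    (fun y => ⟨Function.update y.1 y.2 0, (y.2, y.1 y.2)⟩) ?_ ?_ ?_ ?_ ?_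
  · rintro ⟨c, j, τ⟩ hx
    simp only [Finset.mem_sigma, Finset.mem_filter, Finset.mem_univ, true_and,
      Finset.mem_product, htau] at hx ⊢
    obtain ⟨hc, hj, hτ⟩ := hx
    refine ⟨?_, by simpa using hτ⟩
    rw [freeCoords_update_ne_zero _ _ hτ, Finset.card_erase_of_mem hj, hc]
    rfl
  · rintro ⟨c, j⟩ hx
    simp only [Finset.mem_sigma, Finset.mem_filter, Finset.mem_univ, true_and,
      Finset.mem_product, htau] at hx ⊢
    obtain ⟨hc, hj⟩ := hx
    rw [freeCoords_update_zero]
    refine ⟨?_, Finset.mem_insert_self _ _, hj⟩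
    rw [Finset.card_insert_of_notMem (by simp [freeCoords, hj]), hc]
  · rintro ⟨c, j, τ⟩ hx
    simp only [Finset.mem_sigma, Finset.mem_product] at hx
    have : c j = 0 := by simpa [freeCoords] using hx.2.1
    simp [← this]
  · rintro ⟨c, j⟩ _
    simp
  · rintro ⟨c, j, τ⟩ hx
    simp only [Finset.mem_sigma, Finset.mem_product] at hx
    have : c j = 0 := by simpa [freeCoords] using hx.2.1
    simp [← this]

lemma hemiSum_succ (n : ℕ) (e : ℕ → (Fin n → ℤ) → ZMod 2)
    (he : ∀ k v, v ≠ 0 → e k (-v) = e k v + 1) (M k : ℕ) (hk : k < n) :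
    hemiSum n e M (k + 1) = hemiSum n e M k := by
  set E : (Fin n → SignType) → ZMod 2 := fun c =>
    ∑ v ∈ latticeFace (2 * M + 1) c, e k v * pathSum e k (freeCoords c) v with hE
  have hT : ∀ c : Fin n → SignType,
      ∑ v ∈ latticeFace (2 * M + 1) c, pathSum e (k + 1) (freeCoords c) v =
      ∑ j ∈ freeCoords c, (E (Function.update c j 1) + E (Function.update c j (-1))) := fun c => by
    simp only [pathSum]
    rw [Finset.sum_comm]
    refine Finset.sum_congr rfl fun j hj => ?_
    rw [sum_latticeFace_nbrSum _ _ _ (by simpa [freeCoords] using hj)]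
    simp only [hE]
    rw [freeCoords_update_ne_zero _ _ (by decide), freeCoords_update_ne_zero _ _ (by decide)]
  have hneg : ∑ c : Fin n → SignType with #(freeCoords c) = k, altCoeff n (-1) c * E c =
      ∑ c : Fin n → SignType with #(freeCoords c) = k, altCoeff n 1 c * E (-c) := by
    refine Finset.sum_nbij' (fun c => -c) (fun c => -c) ?_ ?_ ?_ ?_ ?_
    · intro c hc; simpa [freeCoords_neg] using hc
    · intro c hc; simpa [freeCoords_neg] using hc
    · intro c _; simp
    · intro c _; simp
    · intro c _; simp [altCoeff_neg]
  rw [hemiSum]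
  simp only [hT]
  rw [hemiSum_boundary]
  simp only [add_mul]
  rw [Finset.sum_add_distrib, hneg, ← Finset.sum_add_distrib, hemiSum]
  refine Finset.sum_congr rfl fun c hc => ?_
  rw [← mul_add]
  congr 1
  simp only [hE]
  rw [sum_latticeFace_neg, freeCoords_neg, ← Finset.sum_add_distrib]
  refine Finset.sum_congr rfl fun v hv => ?_
  have hlt : #(freeCoords c) < #(Finset.univ : Finset (Fin n)) := by
    simp only [Finset.mem_filter, Finset.mem_univ, true_and] at hc
    simpa [hc] using hk
  obtain ⟨i, -, hi⟩ := Finset.exists_mem_notMem_of_card_lt_card hlt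
  have hci : c i ≠ 0 := by simpa [freeCoords] using hi
  have hvi : v i ≠ 0 := by
    have := (Fintype.mem_piFinset.mp hv) i
    simp only [hci, if_false, Finset.mem_singleton] at this
    rw [this]
    refine mul_ne_zero ?_ (by omega)
    revert hci; generalize c i = x; revert x; decide
  rw [pathSum_neg e he k _ v ⟨i, hi, hvi⟩, he k v (fun h => hvi (by rw [h]; rfl))]
  linear_combination zmod_two_add_self (e k v * pathSum e k (freeCoords c) v)

/-- A discrete Borsuk-Ulam theorem: for antipodal two-colorings `e 0, …, e (d - 1)` of the
lattice points, some small cell of the `d`-skeleton of the cube is bichromatic for each of them. -/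
lemma exists_bichromatic_cell (n d : ℕ) (hd : d ≤ n) (e : ℕ → (Fin n → ℤ) → ZMod 2)
    (he : ∀ k v, v ≠ 0 → e k (-v) = e k v + 1) (M : ℕ) :
    ∃ v : Fin n → ℤ, (∀ i, |v i| ≤ 2 * M + 1) ∧ #{i | |v i| ≠ 2 * M + 1} ≤ d ∧
      ∀ k < d, ∃ u w : Fin n → ℤ, (∀ x, |u x - v x| ≤ 1) ∧ (∀ x, |w x - v x| ≤ 1) ∧
        e k u ≠ e k w := by
  have h1 : ∀ k ≤ n, hemiSum n e M k = 1 := by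
    intro k
    induction k with
    | zero => intro _; exact hemiSum_zero n e M
    | succ k ih => intro hk; rw [hemiSum_succ n e he M k hk]; exact ih (by omega)
  have h2 : hemiSum n e M d ≠ 0 := by rw [h1 d hd]; decide
  obtain ⟨c, hc, hne⟩ := Finset.exists_ne_zero_of_sum_ne_zero h2
  obtain ⟨v, hv, hne'⟩ := Finset.exists_ne_zero_of_sum_ne_zero (right_ne_zero_of_mul hne)
  have hvi := fun i => Fintype.mem_piFinset.mp hv i
  have hfix : ∀ i, c i ≠ 0 → |v i| = 2 * M + 1 := by
    intro i hi
    have := hvi i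
    simp only [hi, if_false, Finset.mem_singleton] at this
    have hN : |(2 * M + 1 : ℤ)| = 2 * M + 1 := abs_of_nonneg (by omega)
    rw [this, abs_mul, hN]
    have : |((c i : SignType) : ℤ)| = 1 := by
      revert hi; generalize c i = x; revert x; decide
    rw [this, one_mul]
  refine ⟨v, fun i => ?_, ?_, exists_ne_of_pathSum_ne_zero e d _ v hne'⟩
  · by_cases hi : c i = 0
    · have := hvi i
      simp only [hi, if_true, Finset.mem_Icc] at this
      exact abs_le.mpr this
    · exact (hfix i hi).le
  · simp only [Finset.mem_filter, Finset.mem_univ, true_and] at hc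
    rw [← hc]
    refine Finset.card_le_card fun i hi => ?_
    simp only [Finset.mem_filter, Finset.mem_univ, true_and, freeCoords] at hi ⊢
    by_contra h
    exact hi (hfix i h)

/-- Borsuk-Ulam on the `d`-skeleton of the cube, in approximate form. -/
lemma exists_skeleton_small (n d : ℕ) (hd : d ≤ n) (G : ℕ → (Fin n → ℝ) → ℝ)
    (hcont : ∀ k, Continuous (G k)) (hodd : ∀ k z, G k (-z) = -G k z) (ε : ℝ) (hε : 0 < ε) :
    ∃ z : Fin n → ℝ, (∀ i, |z i| ≤ 1) ∧ #{i | |z i| ≠ 1} ≤ d ∧ ∀ k < d, |G k z| ≤ ε := by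
  have hunif : ∃ δ > 0, ∀ k < d, ∀ x ∈ Metric.closedBall (0 : Fin n → ℝ) 2,
      ∀ y ∈ Metric.closedBall (0 : Fin n → ℝ) 2, dist x y < δ → |G k x - G k y| < ε := by
    have h : ∀ k, ∃ δ > 0, ∀ x ∈ Metric.closedBall (0 : Fin n → ℝ) 2,
        ∀ y ∈ Metric.closedBall (0 : Fin n → ℝ) 2, dist x y < δ → |G k x - G k y| < ε :=
      fun k => Metric.uniformContinuousOn_iff.mp
        ((isCompact_closedBall _ _).uniformContinuousOn_of_continuous (hcont k).continuousOn) ε hε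
    choose δ hδ hδ' using h
    clear hodd
    induction d with
    | zero => exact ⟨1, one_pos, by simp⟩
    | succ d ih =>
      obtain ⟨η, hη, hη'⟩ := ih (by omega)
      refine ⟨min η (δ d), lt_min hη (hδ d), fun k hk x hx y hy hxy => ?_⟩
      rcases Nat.lt_succ_iff_lt_or_eq.mp hk with hk | rfl
      · exact hη' k hk x hx y hy (hxy.trans_le (min_le_left _ _))
      · exact hδ' k x hx y hy (hxy.trans_le (min_le_right _ _))
  obtain ⟨δ, hδ, hG⟩ := hunif
  obtain ⟨M, hM⟩ := exists_nat_gt (1 / δ)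
  set N : ℝ := 2 * M + 1 with hN
  have hM0 : (0 : ℝ) ≤ M := Nat.cast_nonneg M
  have hN1 : 1 ≤ N := by rw [hN]; linarith
  have hN0 : 0 < N := by linarith
  have hNδ : 1 / N < δ := by
    rw [div_lt_iff₀ hN0]
    rw [div_lt_iff₀ hδ] at hM
    nlinarith
  set r : (Fin n → ℤ) → (Fin n → ℝ) := fun v i => (v i : ℝ) / N with hr
  have hrneg : ∀ v, r (-v) = -r v := fun v => by funext i; simp [hr, neg_div]
  classical
  set e : ℕ → (Fin n → ℤ) → ZMod 2 := fun k v =>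
    if 0 < G k (r v) ∨ (G k (r v) = 0 ∧ toLex 0 < toLex v) then 1 else 0 with he
  have hesucc : ∀ k v, v ≠ 0 → e k (-v) = e k v + 1 := by
    intro k v hv
    simp only [he, hrneg, hodd]
    have hlex : toLex 0 < toLex (-v) ↔ toLex v < toLex 0 := by
      rw [toLex_neg]; exact neg_pos
    rw [hlex]
    rcases lt_trichotomy (G k (r v)) 0 with h | h | h
    · rw [if_pos (Or.inl (by linarith)), if_neg (by
        rintro (h' | ⟨h', -⟩) <;> linarith)]
      rfl
    · rcases lt_trichotomy (toLex v) (toLex 0) with hl | hl | hl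
      · rw [if_pos (Or.inr ⟨by linarith, hl⟩), if_neg (by
          rintro (h' | ⟨-, h'⟩)
          · linarith
          · exact lt_asymm hl h')]
        rfl
      · exact absurd hl hv
      · rw [if_neg (by
          rintro (h' | ⟨-, h'⟩)
          · linarith
          · exact lt_asymm hl h'), if_pos (Or.inr ⟨h, hl⟩)]
        rfl
    · rw [if_neg (by rintro (h' | ⟨h', -⟩) <;> linarith), if_pos (Or.inl h)]
      rfl
  obtain ⟨v, hv1, hv2, hv3⟩ := exists_bichromatic_cell n d hd e hesucc M
  have habs : ∀ i, |r v i| = (|v i| : ℤ) / N := fun i => by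
    simp only [hr, abs_div, abs_of_pos hN0, Int.cast_abs]
  refine ⟨r v, fun i => ?_, ?_, fun k hk => ?_⟩
  · rw [habs, div_le_one hN0, hN]
    exact_mod_cast hv1 i
  · refine le_trans (Finset.card_le_card fun i hi => ?_) hv2
    simp only [Finset.mem_filter, Finset.mem_univ, true_and] at hi ⊢
    intro h
    refine hi ?_
    rw [habs, h, hN]
    push_cast
    exact div_self (by linarith)
  · obtain ⟨u, w, hu, hw, huw⟩ := hv3 k hk
    have hvball : r v ∈ Metric.closedBall (0 : Fin n → ℝ) 2 := by
      rw [mem_closedBall_zero_iff, pi_norm_le_iff_of_nonneg (by norm_num)]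
      intro i
      rw [Real.norm_eq_abs, habs, div_le_iff₀ hN0]
      have : ((|v i| : ℤ) : ℝ) ≤ N := by rw [hN]; exact_mod_cast hv1 i
      linarith
    have hnear : ∀ y : Fin n → ℤ, (∀ x, |y x - v x| ≤ 1) → |G k (r y) - G k (r v)| < ε := by
      intro y hy
      have hdist : dist (r y) (r v) ≤ 1 / N := by
        rw [dist_pi_le_iff (by positivity)]
        intro i
        simp only [hr, Real.dist_eq]
        rw [← sub_div, abs_div, abs_of_pos hN0]
        gcongr
        exact_mod_cast hy i
      refine hG k hk _ ?_ _ hvball (hdist.trans_lt hNδ)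
      rw [mem_closedBall_zero_iff, pi_norm_le_iff_of_nonneg (by norm_num)]
      intro i
      have h1 : |(y i : ℝ) - v i| ≤ 1 := by exact_mod_cast hy i
      have h2 : |(v i : ℝ)| ≤ N := by rw [hN]; exact_mod_cast hv1 i
      have h3 := abs_sub_le (y i : ℝ) (v i) 0
      simp only [sub_zero] at h3
      rw [Real.norm_eq_abs]
      simp only [hr]
      rw [abs_div, abs_of_pos hN0, div_le_iff₀ hN0]
      linarith
    have hsign : ∃ a b : Fin n → ℤ, (∀ x, |a x - v x| ≤ 1) ∧ (∀ x, |b x - v x| ≤ 1) ∧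
        0 ≤ G k (r a) ∧ G k (r b) ≤ 0 := by
      simp only [he] at huw
      by_cases h1 : 0 < G k (r u) ∨ (G k (r u) = 0 ∧ toLex 0 < toLex u) <;>
        by_cases h2 : 0 < G k (r w) ∨ (G k (r w) = 0 ∧ toLex 0 < toLex w)
      · exact absurd (by rw [if_pos h1, if_pos h2]) huw
      · refine ⟨u, w, hu, hw, ?_, le_of_not_gt fun h => h2 (Or.inl h)⟩
        rcases h1 with h | ⟨h, -⟩
        · exact h.le
        · exact h.ge
      · refine ⟨w, u, hw, hu, ?_, le_of_not_gt fun h => h1 (Or.inl h)⟩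
        rcases h2 with h | ⟨h, -⟩
        · exact h.le
        · exact h.ge
      · exact absurd (by rw [if_neg h1, if_neg h2]) huw
    obtain ⟨a, b, ha, hb, ha', hb'⟩ := hsign
    have h1 := abs_lt.mp (hnear a ha)
    have h2 := abs_lt.mp (hnear b hb)
    rw [abs_le]
    constructor <;> linarith

/-- The weight of a point of the two-point space under the Bernoulli measure. -/
def bernoulliWeight (a : ℝ) (b : Bool) : ℝ := if b then a else 1 - a

lemma bernoulliWeight_not (a : ℝ) (b : Bool) :
    bernoulliWeight a (!b) = 1 - bernoulliWeight a b := by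
  cases b <;> simp [bernoulliWeight]

lemma bernoulliWeight_nonneg {a : ℝ} (h0 : 0 ≤ a) (h1 : a ≤ 1) (b : Bool) :
    0 ≤ bernoulliWeight a b := by
  cases b <;> simp [bernoulliWeight] <;> linarith

lemma bernoulliWeight_le_one {a : ℝ} (h0 : 0 ≤ a) (h1 : a ≤ 1) (b : Bool) :
    bernoulliWeight a b ≤ 1 := by
  cases b <;> simp [bernoulliWeight] <;> linarith

lemma biasedWeight_eq_prod {ι : Type*} [Fintype ι] (α : ι → ℝ) (x : ι → Bool) :
    biasedWeight α x = ∏ i, bernoulliWeight (α i) (x i) := rfl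

lemma biasedWeight_nonneg {ι : Type*} [Fintype ι] {α : ι → ℝ} (h0 : ∀ i, 0 ≤ α i)
    (h1 : ∀ i, α i ≤ 1) (x : ι → Bool) : 0 ≤ biasedWeight α x :=
  Finset.prod_nonneg fun i _ => bernoulliWeight_nonneg (h0 i) (h1 i) (x i)

lemma sum_prod_eq_one {n : ℕ} (w : Fin n → Bool → ℝ) (hw : ∀ i, ∑ b, w i b = 1) :
    ∑ x : Fin n → Bool, ∏ i, w i (x i) = 1 := by
  rw [← Fintype.piFinset_univ, ← Finset.prod_univ_sum]
  exact Finset.prod_eq_one fun i _ => hw i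

lemma sum_prod_mul_apply {n : ℕ} (w : Fin n → Bool → ℝ) (hw : ∀ i, ∑ b, w i b = 1) (i : Fin n)
    (h : Bool → ℝ) : ∑ x : Fin n → Bool, (∏ j, w j (x j)) * h (x i) = ∑ b, w i b * h b := by
  have h1 : ∀ x : Fin n → Bool, (∏ j, w j (x j)) * h (x i) =
      ∏ j, (w j (x j) * if j = i then h (x j) else 1) := fun x => by
    rw [Finset.prod_mul_distrib]
    congr 1
    rw [Finset.prod_ite_eq' Finset.univ i fun j => h (x j)]
    simp
  simp only [h1]
  rw [← Fintype.piFinset_univ,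
    ← Finset.prod_univ_sum (fun _ => Finset.univ) fun j b => w j b * if j = i then h b else 1,
    Finset.prod_eq_single i]
  · simp
  · intro j _ hj
    simpa [hj] using hw j
  · simp

lemma sum_biasedWeight {n : ℕ} (α : Fin n → ℝ) : ∑ x, biasedWeight α x = 1 :=
  sum_prod_eq_one (fun i => bernoulliWeight (α i)) fun i => by simp [bernoulliWeight]

lemma sum_fin_succ_bool {n : ℕ} (F : (Fin (n + 1) → Bool) → ℝ) :
    ∑ x, F x = ∑ b, ∑ x : Fin n → Bool, F (Fin.cons b x) := by
  rw [← (Fin.consEquiv fun _ => Bool).sum_comp, Fintype.sum_prod_type]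
  rfl

section Decoupling

variable {X : Type*} [NormedAddCommGroup X] [NormedSpace ℝ X]

lemma symmetrization_one (φ : X → ℝ) (hφ : ConvexOn ℝ Set.univ φ) (w : Bool → ℝ)
    (hw0 : ∀ b, 0 ≤ w b) (hw1 : ∑ b, w b = 1) (V : Bool → X) (hV : ∑ b, w b • V b = 0) (u : X) :
    ∑ b, w b * φ (u + V b) ≤
      ∑ b, w b * ((φ (u + (2 : ℝ) • V b) + φ (u - (2 : ℝ) • V b)) / 2) := by
  have h1 : ∀ b b', φ (u + (V b - V b')) ≤
      (φ (u + (2 : ℝ) • V b) + φ (u - (2 : ℝ) • V b')) / 2 := fun b b' => by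
    have := hφ.2 (Set.mem_univ (u + (2 : ℝ) • V b)) (Set.mem_univ (u - (2 : ℝ) • V b'))
      (by norm_num : (0 : ℝ) ≤ 1 / 2) (by norm_num : (0 : ℝ) ≤ 1 / 2) (by norm_num)
    have heq : (1 / 2 : ℝ) • (u + (2 : ℝ) • V b) + (1 / 2 : ℝ) • (u - (2 : ℝ) • V b') =
        u + (V b - V b') := by module
    rw [heq] at this
    simp only [smul_eq_mul] at this
    linarith
  have h2 : ∀ b, φ (u + V b) ≤ ∑ b', w b' * φ (u + (V b - V b')) := fun b => by
    have := hφ.map_sum_le (t := Finset.univ) (w := w) (p := fun b' => u + (V b - V b'))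
      (fun b _ => hw0 b) hw1 (fun _ _ => Set.mem_univ _)
    have heq : ∑ b', w b' • (u + (V b - V b')) = u + V b := by
      simp only [smul_add, smul_sub, Finset.sum_add_distrib, Finset.sum_sub_distrib, hV,
        ← Finset.sum_smul, hw1, one_smul, sub_zero]
    rw [heq] at this
    simpa only [smul_eq_mul] using this
  simp only [Fintype.sum_bool] at *
  have a1 := h2 true
  have a2 := h2 false
  have b1 := h1 true true
  have b2 := h1 true false
  have b3 := h1 false true
  have b4 := h1 false false
  have c1 := hw0 true
  have c2 := hw0 false
  calc w true * φ (u + V true) + w false * φ (u + V false)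
      ≤ w true * (w true * ((φ (u + (2 : ℝ) • V true) + φ (u - (2 : ℝ) • V true)) / 2) +
          w false * ((φ (u + (2 : ℝ) • V true) + φ (u - (2 : ℝ) • V false)) / 2)) +
        w false * (w true * ((φ (u + (2 : ℝ) • V false) + φ (u - (2 : ℝ) • V true)) / 2) +
          w false * ((φ (u + (2 : ℝ) • V false) + φ (u - (2 : ℝ) • V false)) / 2)) := by
        refine add_le_add (mul_le_mul_of_nonneg_left (a1.trans ?_) c1)
          (mul_le_mul_of_nonneg_left (a2.trans ?_) c2) <;> gcongr
    _ = _ := by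
        have : w false = 1 - w true := by linarith
        rw [this]; ring

lemma symmetrization (φ : X → ℝ) (hφ : ConvexOn ℝ Set.univ φ) {n : ℕ} (w : Fin n → Bool → ℝ)
    (hw0 : ∀ i b, 0 ≤ w i b) (hw1 : ∀ i, ∑ b, w i b = 1) (V : Fin n → Bool → X)
    (hV : ∀ i, ∑ b, w i b • V i b = 0) (u : X) :
    ∑ x : Fin n → Bool, (∏ i, w i (x i)) * φ (u + ∑ i, V i (x i)) ≤
      ∑ x : Fin n → Bool, (∏ i, w i (x i)) *
        ((2 ^ n : ℝ)⁻¹ * ∑ ε : Fin n → Bool, φ (u + ∑ i, sgn (ε i) • (2 : ℝ) • V i (x i))) := by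
  induction n generalizing u with
  | zero => simp
  | succ n ih =>
    rw [sum_fin_succ_bool, sum_fin_succ_bool]
    simp only [sum_fin_succ_bool (n := n) (fun ε => φ _), Fin.prod_univ_succ, Fin.sum_univ_succ,
      Fin.cons_zero, Fin.cons_succ]
    calc ∑ b, ∑ x : Fin n → Bool, (w 0 b * ∏ i : Fin n, w i.succ (x i)) *
          φ (u + (V 0 b + ∑ i : Fin n, V i.succ (x i)))
        = ∑ b, w 0 b * ∑ x : Fin n → Bool, (∏ i : Fin n, w i.succ (x i)) *
          φ ((u + V 0 b) + ∑ i : Fin n, V i.succ (x i)) := by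
          simp only [Finset.mul_sum, mul_assoc, add_assoc]
      _ ≤ ∑ b, w 0 b * ∑ x : Fin n → Bool, (∏ i : Fin n, w i.succ (x i)) *
          ((2 ^ n : ℝ)⁻¹ * ∑ ε : Fin n → Bool,
            φ ((u + V 0 b) + ∑ i, sgn (ε i) • (2 : ℝ) • V i.succ (x i))) := by
          refine Finset.sum_le_sum fun b _ => mul_le_mul_of_nonneg_left ?_ (hw0 0 b)
          exact ih (fun i => w i.succ) (fun i => hw0 _) (fun i => hw1 _) (fun i => V i.succ)
            (fun i => hV _) _
      _ = ∑ x : Fin n → Bool, (∏ i : Fin n, w i.succ (x i)) * ((2 ^ n : ℝ)⁻¹ *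
          ∑ ε : Fin n → Bool, ∑ b, w 0 b *
            φ ((u + ∑ i, sgn (ε i) • (2 : ℝ) • V i.succ (x i)) + V 0 b)) := by
          simp only [Finset.mul_sum]
          rw [Finset.sum_comm]
          refine Finset.sum_congr rfl fun x _ => ?_
          rw [Finset.sum_comm]
          refine Finset.sum_congr rfl fun ε _ => Finset.sum_congr rfl fun b _ => ?_
          rw [add_right_comm]
          ring
      _ ≤ ∑ x : Fin n → Bool, (∏ i : Fin n, w i.succ (x i)) * ((2 ^ n : ℝ)⁻¹ *
          ∑ ε : Fin n → Bool, ∑ b, w 0 b *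
            ((φ ((u + ∑ i, sgn (ε i) • (2 : ℝ) • V i.succ (x i)) + (2 : ℝ) • V 0 b) +
              φ ((u + ∑ i, sgn (ε i) • (2 : ℝ) • V i.succ (x i)) - (2 : ℝ) • V 0 b)) / 2)) := by
          refine Finset.sum_le_sum fun x _ => mul_le_mul_of_nonneg_left ?_
            (Finset.prod_nonneg fun i _ => hw0 _ _)
          refine mul_le_mul_of_nonneg_left (Finset.sum_le_sum fun ε _ => ?_) (by positivity)
          exact symmetrization_one φ hφ (w 0) (hw0 0) (hw1 0) (V 0) (hV 0) _
      _ = _ := by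
          simp only [Finset.mul_sum]
          rw [Finset.sum_comm (s := (Finset.univ : Finset Bool))]
          refine Finset.sum_congr rfl fun x _ => ?_
          rw [Finset.sum_comm]
          refine Finset.sum_congr rfl fun b _ => ?_
          rw [Finset.sum_comm]
          refine Finset.sum_congr rfl fun ε _ => ?_
          have e1 : u + ∑ i, sgn (ε i) • (2 : ℝ) • V i.succ (x i) + (2 : ℝ) • V 0 b =
              u + (sgn true • (2 : ℝ) • V 0 b + ∑ i, sgn (ε i) • (2 : ℝ) • V i.succ (x i)) := by
            simp only [sgn, if_true, one_smul]; abel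
          have e2 : u + ∑ i, sgn (ε i) • (2 : ℝ) • V i.succ (x i) - (2 : ℝ) • V 0 b =
              u + (sgn false • (2 : ℝ) • V 0 b + ∑ i, sgn (ε i) • (2 : ℝ) • V i.succ (x i)) := by
            simp only [sgn, Bool.false_eq_true, if_false, neg_smul, one_smul]; abel
          rw [e1, e2, Fintype.sum_bool, pow_succ, mul_inv]
          ring

lemma convexOn_norm_rpow {p : ℝ} (hp : 1 ≤ p) : ConvexOn ℝ Set.univ fun x : X => ‖x‖ ^ p := by
  refine ⟨convex_univ, fun x _ y _ a b ha hb hab => ?_⟩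
  have h1 : ‖a • x + b • y‖ ≤ a * ‖x‖ + b * ‖y‖ := by
    refine (norm_add_le _ _).trans ?_
    rw [norm_smul, norm_smul, Real.norm_of_nonneg ha, Real.norm_of_nonneg hb]
  exact (Real.rpow_le_rpow (norm_nonneg _) h1 (by linarith)).trans
    ((convexOn_rpow hp).2 (Set.mem_Ici.2 (norm_nonneg x)) (Set.mem_Ici.2 (norm_nonneg y))
      ha hb hab)

/-- Rademacher type for sums of independent centered two-valued random vectors. -/
lemma RademacherType.sum_centered_le {p T : ℝ} (hp : 1 ≤ p) (hT : 0 < T)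
    (hX : RademacherType X p T) {n : ℕ} (w : Fin n → Bool → ℝ)
    (hw0 : ∀ i b, 0 ≤ w i b) (hw1 : ∀ i, ∑ b, w i b = 1) (V : Fin n → Bool → X)
    (hV : ∀ i, ∑ b, w i b • V i b = 0) :
    ∑ x : Fin n → Bool, (∏ i, w i (x i)) * ‖∑ i, V i (x i)‖ ^ p ≤
      (2 * T) ^ p * ∑ i, ∑ b, w i b * ‖V i b‖ ^ p := by
  have h1 := symmetrization (fun x : X => ‖x‖ ^ p) (convexOn_norm_rpow hp) w hw0 hw1 V hV 0
  simp only [zero_add] at h1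
  refine h1.trans ?_
  calc _ ≤ ∑ x : Fin n → Bool, (∏ i, w i (x i)) * (T ^ p * ∑ i, ‖(2 : ℝ) • V i (x i)‖ ^ p) :=
        Finset.sum_le_sum fun x _ => mul_le_mul_of_nonneg_left (hX n _)
          (Finset.prod_nonneg fun i _ => hw0 _ _)
    _ = (2 * T) ^ p * ∑ i, ∑ x : Fin n → Bool, (∏ j, w j (x j)) * ‖V i (x i)‖ ^ p := by
        rw [Finset.sum_comm, Finset.mul_sum]
        refine Finset.sum_congr rfl fun x _ => ?_
        rw [Finset.mul_sum, Finset.mul_sum, Finset.mul_sum]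
        refine Finset.sum_congr rfl fun i _ => ?_
        rw [norm_smul, Real.norm_of_nonneg (by norm_num), Real.mul_rpow (by norm_num)
          (norm_nonneg _), Real.mul_rpow (by norm_num) hT.le]
        ring
    _ = _ := by
        congr 1
        exact Finset.sum_congr rfl fun i _ =>
          sum_prod_mul_apply w hw1 i fun b => ‖V i b‖ ^ p

end Decoupling

/-- The transition kernel of the two-point space that keeps the current state with probability
`r` and resamples it otherwise. -/
def resample (a r : ℝ) (b b' : Bool) : ℝ :=
  (if b = b' then r else 0) + (1 - r) * bernoulliWeight a b'

/-- The logarithmic derivative of `resample` in `r`. -/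
def resampleScore (a r : ℝ) (b b' : Bool) : ℝ :=
  if b = b' then bernoulliWeight a (!b') / (r + (1 - r) * bernoulliWeight a b') else -(1 / (1 - r))

lemma resample_nonneg {a r : ℝ} (h0 : 0 ≤ a) (h1 : a ≤ 1) (hr0 : 0 ≤ r) (hr1 : r ≤ 1)
    (b b' : Bool) : 0 ≤ resample a r b b' := by
  have := bernoulliWeight_nonneg h0 h1 b'
  have h2 : 0 ≤ 1 - r := by linarith
  unfold resample
  split_ifs <;> positivity

lemma sum_resample (a r : ℝ) (b : Bool) : ∑ b', resample a r b b' = 1 := by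
  cases b <;> simp [resample, bernoulliWeight] <;> ring

lemma resample_symm (a r : ℝ) (b b' : Bool) :
    bernoulliWeight a b * resample a r b b' = bernoulliWeight a b' * resample a r b' b := by
  cases b <;> cases b' <;> simp [resample, bernoulliWeight] <;> ring

lemma resample_mul_score {a r : ℝ} (h0 : 0 ≤ a) (h1 : a ≤ 1) (hr0 : 0 < r) (hr1 : r < 1)
    (b b' : Bool) : resample a r b b' * resampleScore a r b b' =
      (if b = b' then 1 else 0) - bernoulliWeight a b' := by
  have hm := bernoulliWeight_nonneg h0 h1 b'
  have h2 : 0 < 1 - r := by linarith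
  have h3 : r + (1 - r) * bernoulliWeight a b' ≠ 0 := by positivity
  unfold resample resampleScore
  rw [bernoulliWeight_not]
  split_ifs
  · field_simp
  · field_simp
    ring

lemma sum_resample_mul_score {a r : ℝ} (h0 : 0 ≤ a) (h1 : a ≤ 1) (hr0 : 0 < r) (hr1 : r < 1)
    (b : Bool) : ∑ b', resample a r b b' * resampleScore a r b' b = 0 := by
  have hm := bernoulliWeight_nonneg h0 h1 b
  have h2 : 0 < 1 - r := by linarith
  have h3 : r + (1 - r) * bernoulliWeight a b ≠ 0 := by positivity
  have h4 : ∑ b', resample a r b b' * resampleScore a r b' b =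
      resample a r b b * resampleScore a r b b +
        resample a r b (!b) * resampleScore a r (!b) b := by
    cases b <;> simp [add_comm]
  rw [h4, resample_mul_score h0 h1 hr0 hr1]
  have hne : b ≠ !b := by cases b <;> decide
  simp only [resample, resampleScore, bernoulliWeight_not, hne, hne.symm, if_false, if_true]
  field_simp
  ring

lemma mul_div_rpow_le {p r q m : ℝ} (hp1 : 1 ≤ p) (hp2 : p ≤ 2) (hr0 : 0 < r) (hr1 : r ≤ 1)
    (hq : r ≤ q) (hm0 : 0 ≤ m) (hm1 : m ≤ 1) : q * (m / q) ^ p ≤ (1 / √r) ^ p := by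
  have hq0 : 0 < q := hr0.trans_le hq
  calc q * (m / q) ^ p ≤ q * (1 / q) ^ p := by gcongr
    _ = q ^ (1 - p) := by
        rw [Real.rpow_sub hq0, Real.rpow_one, one_div, Real.inv_rpow hq0.le]; rfl
    _ ≤ r ^ (1 - p) := Real.rpow_le_rpow_of_nonpos hr0 hq (by linarith)
    _ ≤ r ^ (-(1 / 2) * p) := Real.rpow_le_rpow_of_exponent_ge hr0 hr1 (by linarith)
    _ = (1 / √r) ^ p := by
        rw [Real.rpow_mul hr0.le, Real.rpow_neg hr0.le, ← Real.sqrt_eq_rpow, one_div]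

lemma sum_resample_score_rpow_le {a r p : ℝ} (h0 : 0 ≤ a) (h1 : a ≤ 1) (hr0 : 0 < r) (hr1 : r < 1)
    (hp1 : 1 ≤ p) (hp2 : p ≤ 2) (b : Bool) :
    ∑ b', resample a r b b' * (|resampleScore a r b' b| * bernoulliWeight a (!b)) ^ p ≤
      (1 / √r + 1 / √(1 - r)) ^ p := by
  have hm := bernoulliWeight_nonneg h0 h1 b
  have hm' := bernoulliWeight_nonneg h0 h1 (!b)
  have hm1 := bernoulliWeight_le_one h0 h1 (!b)
  have h2 : 0 < 1 - r := by linarith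
  have hp0 : 0 < p := by linarith
  have h4 : ∑ b', resample a r b b' * (|resampleScore a r b' b| * bernoulliWeight a (!b)) ^ p =
      resample a r b b * (|resampleScore a r b b| * bernoulliWeight a (!b)) ^ p +
        resample a r b (!b) * (|resampleScore a r (!b) b| * bernoulliWeight a (!b)) ^ p := by
    cases b <;> simp [add_comm]
  have hne : b ≠ !b := by cases b <;> decide
  have hmm : bernoulliWeight a (!b) * bernoulliWeight a (!b) ≤ 1 := by nlinarith
  have hq : 0 < r + (1 - r) * bernoulliWeight a b := by positivity
  have e1 : resample a r b b * (|resampleScore a r b b| * bernoulliWeight a (!b)) ^ p ≤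
      (1 / √r) ^ p := by
    have : |resampleScore a r b b| * bernoulliWeight a (!b) =
        (bernoulliWeight a (!b) * bernoulliWeight a (!b)) /
          (r + (1 - r) * bernoulliWeight a b) := by
      rw [resampleScore, if_pos rfl, abs_of_nonneg (by positivity)]
      ring
    rw [this, resample, if_pos rfl]
    exact mul_div_rpow_le hp1 hp2 hr0 hr1.le (by nlinarith) (by positivity) hmm
  have e2 : resample a r b (!b) * (|resampleScore a r (!b) b| * bernoulliWeight a (!b)) ^ p ≤
      (1 / √(1 - r)) ^ p := by
    have : |resampleScore a r (!b) b| * bernoulliWeight a (!b) =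
        bernoulliWeight a (!b) / (1 - r) := by
      rw [resampleScore, if_neg hne.symm, abs_neg, abs_of_nonneg (by positivity)]
      ring
    rw [this, resample, if_neg hne, zero_add]
    refine le_trans ?_ (mul_div_rpow_le hp1 hp2 h2 (by linarith) le_rfl hm' hm1)
    have : 0 ≤ (bernoulliWeight a (!b) / (1 - r)) ^ p := by positivity
    gcongr
    nlinarith
  rw [h4]
  refine (add_le_add e1 e2).trans ?_
  exact Real.add_rpow_le_rpow_add (by positivity) (by positivity) hp1

/-- The density of the product of the kernels `resample`. -/
def resampleProd {n : ℕ} (α : Fin n → ℝ) (r : ℝ) (x y : Fin n → Bool) : ℝ :=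
  ∏ i, resample (α i) r (x i) (y i)

/-- The derivative of `g` in direction `i`, centered under the measure with weight `α`. -/
def centeredDeriv {n : ℕ} {X : Type*} [AddCommGroup X] [Module ℝ X] (α : Fin n → ℝ)
    (g : (Fin n → Bool) → X) (i : Fin n) (y : Fin n → Bool) : X :=
  bernoulliWeight (α i) (!(y i)) • (g y - g (flipc y i))

lemma flipc_flipc {ι : Type*} [DecidableEq ι] (x : ι → Bool) (i : ι) :
    flipc (flipc x i) i = x := by
  simp [flipc]

lemma flipc_self {ι : Type*} [DecidableEq ι] (x : ι → Bool) (i : ι) : flipc x i i = !(x i) := by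
  simp [flipc]

lemma flipc_of_ne {ι : Type*} [DecidableEq ι] (x : ι → Bool) {i j : ι} (h : j ≠ i) :
    flipc x i j = x j := by
  simp [flipc, h]

lemma hasDerivAt_resample (a r : ℝ) (b b' : Bool) : HasDerivAt (fun r => resample a r b b')
    ((if b = b' then 1 else 0) - bernoulliWeight a b') r := by
  unfold resample
  have h1 : HasDerivAt (fun r : ℝ => (1 - r) * bernoulliWeight a b')
      ((0 - 1) * bernoulliWeight a b') r :=
    ((hasDerivAt_const r (1 : ℝ)).sub (hasDerivAt_id r)).mul_const _
  have h2 : HasDerivAt (fun r : ℝ => if b = b' then r else 0) (if b = b' then 1 else 0) r := by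
    split_ifs
    · exact hasDerivAt_id r
    · exact hasDerivAt_const r 0
  exact (h2.add h1).congr_deriv (by ring)

lemma hasDerivAt_resampleProd {n : ℕ} (α : Fin n → ℝ) (r : ℝ) (x y : Fin n → Bool) :
    HasDerivAt (fun r => resampleProd α r x y)
      (∑ i, (∏ j ∈ Finset.univ.erase i, resample (α j) r (x j) (y j)) *
        ((if x i = y i then 1 else 0) - bernoulliWeight (α i) (y i))) r := by
  unfold resampleProd
  exact HasDerivAt.fun_finsetProd (u := Finset.univ)
    (f := fun i r => resample (α i) r (x i) (y i))
    (fun i _ => hasDerivAt_resample (α i) r (x i) (y i))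

lemma resampleProd_one {n : ℕ} (α : Fin n → ℝ) (x y : Fin n → Bool) :
    resampleProd α 1 x y = if x = y then 1 else 0 := by
  simp only [resampleProd, resample, sub_self, zero_mul, add_zero, Finset.prod_ite_zero,
    Finset.prod_const_one, Finset.mem_univ, true_imp_iff, funext_iff]

lemma resampleProd_zero {n : ℕ} (α : Fin n → ℝ) (x y : Fin n → Bool) :
    resampleProd α 0 x y = biasedWeight α y := by
  simp [resampleProd, resample, biasedWeight_eq_prod]

lemma resampleProd_symm {n : ℕ} (α : Fin n → ℝ) (r : ℝ) (x y : Fin n → Bool) :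
    biasedWeight α x * resampleProd α r x y = biasedWeight α y * resampleProd α r y x := by
  simp only [biasedWeight_eq_prod, resampleProd, ← Finset.prod_mul_distrib, resample_symm]

section Pisier

variable {X : Type*} [NormedAddCommGroup X] [NormedSpace ℝ X]

lemma sum_mul_apply_eq_centeredDeriv {n : ℕ} (α : Fin n → ℝ) (r : ℝ) (x : Fin n → Bool)
    (i : Fin n) (g : (Fin n → Bool) → X) (l : X →L[ℝ] ℝ) :
    ∑ y, (∏ j ∈ Finset.univ.erase i, resample (α j) r (x j) (y j)) *
        ((if x i = y i then 1 else 0) - bernoulliWeight (α i) (y i)) * l (g y) =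
      ∑ y, (∏ j ∈ Finset.univ.erase i, resample (α j) r (x j) (y j)) *
        ((if x i = y i then 1 else 0) - bernoulliWeight (α i) (y i)) *
          l (centeredDeriv α g i y) := by
  rw [← sub_eq_zero, ← Finset.sum_sub_distrib]
  set F : (Fin n → Bool) → ℝ := fun y =>
    (∏ j ∈ Finset.univ.erase i, resample (α j) r (x j) (y j)) *
        ((if x i = y i then 1 else 0) - bernoulliWeight (α i) (y i)) * l (g y) -
      (∏ j ∈ Finset.univ.erase i, resample (α j) r (x j) (y j)) *
        ((if x i = y i then 1 else 0) - bernoulliWeight (α i) (y i)) *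
          l (centeredDeriv α g i y) with hF
  have hinv : Function.Involutive fun y : Fin n → Bool => flipc y i := fun y => flipc_flipc y i
  have hsum : ∑ y, F (flipc y i) = ∑ y, F y := Equiv.sum_comp hinv.toPerm F
  have hneg : ∀ y, F (flipc y i) = -F y := fun y => by
    have hprod : ∏ j ∈ Finset.univ.erase i, resample (α j) r (x j) (flipc y i j) =
        ∏ j ∈ Finset.univ.erase i, resample (α j) r (x j) (y j) :=
      Finset.prod_congr rfl fun j hj => by rw [flipc_of_ne y (Finset.ne_of_mem_erase hj)]
    simp only [hF, hprod, flipc_self, centeredDeriv, flipc_flipc, map_smul, map_sub, smul_eq_mul,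
      bernoulliWeight_not]
    have : (if x i = !(y i) then (1 : ℝ) else 0) = 1 - if x i = y i then 1 else 0 := by
      cases x i <;> cases y i <;> simp
    rw [this]
    ring
  have : ∑ y, F y = -∑ y, F y := by
    conv_lhs => rw [← hsum]
    simp only [hneg, Finset.sum_neg_distrib]
  change ∑ y, F y = 0
  linarith

lemma sum_resampleProd_norm_le {p T : ℝ} (hp1 : 1 ≤ p) (hp2 : p ≤ 2) (hT : 0 < T)
    (hX : RademacherType X p T) {n : ℕ} {α : Fin n → ℝ} (h0 : ∀ i, 0 ≤ α i)
    (h1 : ∀ i, α i ≤ 1) {k : ℕ} (hk : #{i | α i ≠ 0 ∧ α i ≠ 1} ≤ k) {L : ℝ} (hL : 0 ≤ L)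
    {g : (Fin n → Bool) → X} (hg : ∀ y i, ‖g y - g (flipc y i)‖ ≤ L) {r : ℝ} (hr0 : 0 < r)
    (hr1 : r < 1) {y : Fin n → Bool} (hy : biasedWeight α y ≠ 0) :
    ∑ x, resampleProd α r y x *
        ‖∑ i, resampleScore (α i) r (x i) (y i) • centeredDeriv α g i y‖ ≤
      2 * T * (k : ℝ) ^ (1 / p) * L * (1 / √r + 1 / √(1 - r)) := by
  have hp0 : 0 < p := by linarith
  set S := 1 / √r + 1 / √(1 - r) with hS
  have hS0 : 0 ≤ S := by positivity
  have hQ0 : ∀ i b, 0 ≤ resample (α i) r (y i) b := fun i b =>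
    resample_nonneg (h0 i) (h1 i) hr0.le hr1.le _ _
  have hQ1 : ∀ i, ∑ b, resample (α i) r (y i) b = 1 := fun i => sum_resample _ _ _
  have hcoord : ∀ i, ∑ b, resample (α i) r (y i) b *
      ‖resampleScore (α i) r b (y i) • centeredDeriv α g i y‖ ^ p ≤
        if α i ≠ 0 ∧ α i ≠ 1 then (L * S) ^ p else 0 := fun i => by
    split_ifs with hi
    · calc _ ≤ ∑ b, resample (α i) r (y i) b *
            (L * (|resampleScore (α i) r b (y i)| * bernoulliWeight (α i) (!(y i)))) ^ p := by
            refine Finset.sum_le_sum fun b _ => mul_le_mul_of_nonneg_left ?_ (hQ0 i b)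
            refine Real.rpow_le_rpow (norm_nonneg _) ?_ hp0.le
            rw [centeredDeriv, norm_smul, norm_smul, Real.norm_eq_abs,
              Real.norm_of_nonneg (bernoulliWeight_nonneg (h0 i) (h1 i) _), ← mul_assoc,
              mul_comm]
            exact mul_le_mul_of_nonneg_right (hg y i)
              (mul_nonneg (abs_nonneg _) (bernoulliWeight_nonneg (h0 i) (h1 i) _))
        _ = L ^ p * ∑ b, resample (α i) r (y i) b *
            (|resampleScore (α i) r b (y i)| * bernoulliWeight (α i) (!(y i))) ^ p := by
            rw [Finset.mul_sum]
            refine Finset.sum_congr rfl fun b _ => ?_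
            rw [Real.mul_rpow hL
              (mul_nonneg (abs_nonneg _) (bernoulliWeight_nonneg (h0 i) (h1 i) _))]
            ring
        _ ≤ L ^ p * S ^ p := by
            gcongr
            exact sum_resample_score_rpow_le (h0 i) (h1 i) hr0 hr1 hp1 hp2 (y i)
        _ = (L * S) ^ p := (Real.mul_rpow hL hS0).symm
    · have hyi : bernoulliWeight (α i) (y i) ≠ 0 := fun h =>
        hy (by rw [biasedWeight_eq_prod]; exact Finset.prod_eq_zero (Finset.mem_univ i) h)
      have hz : bernoulliWeight (α i) (!(y i)) = 0 := by
        have hor : α i = 0 ∨ α i = 1 := by tauto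
        rcases hor with h | h <;> rw [h] at hyi ⊢ <;> cases hb : y i <;>
          simp_all [bernoulliWeight]
      simp [centeredDeriv, hz, hp0.ne']
  have hmom : ∑ x, resampleProd α r y x *
      ‖∑ i, resampleScore (α i) r (x i) (y i) • centeredDeriv α g i y‖ ^ p ≤
        (2 * T) ^ p * (k * (L * S) ^ p) := by
    refine (hX.sum_centered_le hp1 hT (fun i b => resample (α i) r (y i) b) hQ0 hQ1
      (fun i b => resampleScore (α i) r b (y i) • centeredDeriv α g i y) fun i => ?_).trans ?_
    · simp only [smul_smul, ← Finset.sum_smul]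
      rw [sum_resample_mul_score (h0 i) (h1 i) hr0 hr1, zero_smul]
    · refine mul_le_mul_of_nonneg_left ((Finset.sum_le_sum fun i _ => hcoord i).trans ?_)
        (by positivity)
      rw [← Finset.sum_filter, Finset.sum_const, nsmul_eq_mul]
      gcongr
  refine (Real.arith_mean_le_rpow_mean Finset.univ _ _
    (fun x _ => Finset.prod_nonneg fun i _ => hQ0 i (x i)) (sum_prod_eq_one _ hQ1)
    (fun x _ => norm_nonneg _) hp1).trans ?_
  refine (Real.rpow_le_rpow ?_ hmom (by positivity)).trans_eq ?_
  · exact Finset.sum_nonneg fun x _ =>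
      mul_nonneg (Finset.prod_nonneg fun i _ => hQ0 i (x i)) (by positivity)
  · have hroot : ∀ a : ℝ, 0 ≤ a → (a ^ p) ^ (1 / p) = a := fun a ha => by
      rw [← Real.rpow_mul ha, mul_one_div_cancel hp0.ne', Real.rpow_one]
    rw [Real.mul_rpow (x := (2 * T) ^ p) (by positivity) (by positivity),
      Real.mul_rpow (x := (k : ℝ)) (by positivity) (by positivity), hroot _ (by positivity),
      hroot _ (by positivity)]
    ring

/-- A dimension-free Poincaré inequality of Pisier-Enflo type on the biased cube. -/
lemma sum_biasedWeight_norm_sub_le {p T : ℝ} (hp1 : 1 ≤ p) (hp2 : p ≤ 2) (hT : 0 < T)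
    (hX : RademacherType X p T) {n : ℕ} {α : Fin n → ℝ} (h0 : ∀ i, 0 ≤ α i)
    (h1 : ∀ i, α i ≤ 1) {k : ℕ} (hk : #{i | α i ≠ 0 ∧ α i ≠ 1} ≤ k) {L : ℝ} (hL : 0 ≤ L)
    {g : (Fin n → Bool) → X} (hg : ∀ y i, ‖g y - g (flipc y i)‖ ≤ L) :
    ∑ x, biasedWeight α x * ‖g x - ∑ y, biasedWeight α y • g y‖ ≤
      8 * T * (k : ℝ) ^ (1 / p) * L := by
  set E := ∑ y, biasedWeight α y • g y with hE
  set K := 2 * T * (k : ℝ) ^ (1 / p) * L with hK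
  have hμ := biasedWeight_nonneg h0 h1
  choose l hl1 hl2 using fun x => exists_dual_vector'' ℝ (g x - E)
  set Φ : ℝ → ℝ := fun r => ∑ x, ∑ y, biasedWeight α x * (resampleProd α r x y * l x (g y))
    with hΦ
  have hΦ1 : Φ 1 = ∑ x, biasedWeight α x * l x (g x) := by
    simp [hΦ, resampleProd_one]
  have hΦ0 : Φ 0 = ∑ x, biasedWeight α x * l x E := by
    simp only [hΦ, resampleProd_zero, hE, map_sum, map_smul, smul_eq_mul, Finset.mul_sum]
  set Φ' : ℝ → ℝ := fun r => ∑ x, ∑ y, biasedWeight α x *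
    ((∑ i, (∏ j ∈ Finset.univ.erase i, resample (α j) r (x j) (y j)) *
        ((if x i = y i then 1 else 0) - bernoulliWeight (α i) (y i))) * l x (g y)) with hΦ'
  have hder : ∀ r, HasDerivAt Φ (Φ' r) r := fun r =>
    HasDerivAt.fun_sum fun x _ => HasDerivAt.fun_sum fun y _ =>
      ((hasDerivAt_resampleProd α r x y).mul_const _).const_mul _
  have hbound : ∀ r, 0 < r → r < 1 → Φ' r ≤ K * (1 / √r + 1 / √(1 - r)) := by
    intro r hr0 hr1
    have hQ0 : ∀ x y, 0 ≤ resampleProd α r x y := fun x y =>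
      Finset.prod_nonneg fun i _ => resample_nonneg (h0 i) (h1 i) hr0.le hr1.le _ _
    have e1 : Φ' r = ∑ x, ∑ y, biasedWeight α x * (resampleProd α r x y *
        l x (∑ i, resampleScore (α i) r (x i) (y i) • centeredDeriv α g i y)) := by
      refine Finset.sum_congr rfl fun x _ => ?_
      rw [← Finset.mul_sum, ← Finset.mul_sum]
      congr 1
      simp only [Finset.sum_mul, map_sum, Finset.mul_sum]
      rw [Finset.sum_comm, Finset.sum_comm (s := (Finset.univ : Finset (Fin n → Bool)))]
      refine Finset.sum_congr rfl fun i _ => ?_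
      rw [sum_mul_apply_eq_centeredDeriv]
      refine Finset.sum_congr rfl fun y _ => ?_
      rw [← resample_mul_score (h0 i) (h1 i) hr0 hr1, map_smul, smul_eq_mul, resampleProd,
        ← Finset.mul_prod_erase _ _ (Finset.mem_univ i)]
      ring
    calc Φ' r ≤ ∑ x, ∑ y, biasedWeight α x * (resampleProd α r x y *
          ‖∑ i, resampleScore (α i) r (x i) (y i) • centeredDeriv α g i y‖) := by
          rw [e1]
          refine Finset.sum_le_sum fun x _ => Finset.sum_le_sum fun y _ =>
            mul_le_mul_of_nonneg_left (mul_le_mul_of_nonneg_left ?_ (hQ0 x y)) (hμ x)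
          refine (le_abs_self _).trans (((l x).le_opNorm _).trans ?_)
          exact mul_le_of_le_one_left (norm_nonneg _) (hl1 x)
      _ = ∑ y, biasedWeight α y * ∑ x, resampleProd α r y x *
          ‖∑ i, resampleScore (α i) r (x i) (y i) • centeredDeriv α g i y‖ := by
          rw [Finset.sum_comm]
          refine Finset.sum_congr rfl fun y _ => ?_
          rw [Finset.mul_sum]
          refine Finset.sum_congr rfl fun x _ => ?_
          rw [← mul_assoc, ← mul_assoc, resampleProd_symm]
      _ ≤ ∑ y, biasedWeight α y * (K * (1 / √r + 1 / √(1 - r))) := by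
          refine Finset.sum_le_sum fun y _ => ?_
          by_cases hy : biasedWeight α y = 0
          · simp [hy]
          · exact mul_le_mul_of_nonneg_left
              (sum_resampleProd_norm_le hp1 hp2 hT hX h0 h1 hk hL hg hr0 hr1 hy) (hμ y)
      _ = K * (1 / √r + 1 / √(1 - r)) := by
          rw [← Finset.sum_mul, sum_biasedWeight, one_mul]
  have hanti : AntitoneOn (fun r => Φ r - K * (2 * √r - 2 * √(1 - r))) (Set.Icc 0 1) := by
    have hd : ∀ r ∈ Set.Ioo (0 : ℝ) 1, HasDerivAt
        (fun r => Φ r - K * (2 * √r - 2 * √(1 - r)))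
        (Φ' r - K * (1 / √r + 1 / √(1 - r))) r := fun r hr => by
      have a1 : HasDerivAt (fun r : ℝ => √r) (1 / (2 * √r)) r := Real.hasDerivAt_sqrt hr.1.ne'
      have a2 : HasDerivAt (fun r : ℝ => √(1 - r)) ((0 - 1) / (2 * √(1 - r))) r :=
        ((hasDerivAt_const r (1 : ℝ)).sub (hasDerivAt_id r)).sqrt (by
          exact (sub_pos.2 hr.2).ne')
      refine ((hder r).sub (((a1.const_mul 2).sub (a2.const_mul 2)).const_mul K)).congr_deriv ?_
      have b1 : √r ≠ 0 := (Real.sqrt_pos.2 hr.1).ne'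
      have b2 : √(1 - r) ≠ 0 := (Real.sqrt_pos.2 (by linarith [hr.2])).ne'
      field_simp
      ring
    refine antitoneOn_of_deriv_nonpos (convex_Icc 0 1) ?_ ?_ ?_
    · have : Continuous Φ := continuous_iff_continuousAt.2 fun r => (hder r).continuousAt
      fun_prop
    · rw [interior_Icc]
      exact fun r hr => (hd r hr).differentiableAt.differentiableWithinAt
    · rw [interior_Icc]
      intro r hr
      rw [(hd r hr).deriv]
      linarith [hbound r hr.1 hr.2]
  have hle := hanti (Set.left_mem_Icc.2 zero_le_one) (Set.right_mem_Icc.2 zero_le_one)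
    zero_le_one
  simp only [sub_self, Real.sqrt_zero, Real.sqrt_one, sub_zero, hΦ0, hΦ1] at hle
  have hsplit : ∑ x, biasedWeight α x * ‖g x - E‖ =
      ∑ x, biasedWeight α x * l x (g x) - ∑ x, biasedWeight α x * l x E := by
    rw [← Finset.sum_sub_distrib]
    refine Finset.sum_congr rfl fun x _ => ?_
    have := hl2 x
    rw [map_sub] at this
    rw [← mul_sub, this]
    rfl
  rw [hsplit]
  linarith

end Pisier

lemma negc_negc {ι : Type*} (x : ι → Bool) : negc (negc x) = x := by
  funext i
  simp [negc]

lemma negc_flipc {ι : Type*} [DecidableEq ι] (x : ι → Bool) (i : ι) :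
    negc (flipc x i) = flipc (negc x) i := by
  funext j
  by_cases h : j = i
  · subst h; simp [negc, flipc_self]
  · simp [negc, flipc_of_ne _ h]

lemma hamming_negc {n : ℕ} (x : Fin n → Bool) : hamming x (negc x) = n := by
  have : ∀ i, x i ≠ negc x i := fun i => by simp [negc]
  simp [hamming, this]

lemma hamming_flipc {n : ℕ} (x : Fin n → Bool) (i : Fin n) : hamming x (flipc x i) = 1 := by
  have : (Finset.univ.filter fun j => x j ≠ flipc x i j) = {i} := by
    ext j
    by_cases h : j = i
    · subst h; simp [flipc_self]
    · simp [flipc_of_ne _ h, h]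
  rw [hamming, this, Finset.card_singleton]

/-- The multilinear extension of `g` to the solid cube. -/
def multilinearExt {n : ℕ} {X : Type*} [AddCommGroup X] [Module ℝ X] (g : (Fin n → Bool) → X)
    (z : Fin n → ℝ) : X :=
  ∑ x, biasedWeight (fun i => (1 + z i) / 2) x • g x

lemma biasedWeight_neg_negc {n : ℕ} (z : Fin n → ℝ) (x : Fin n → Bool) :
    biasedWeight (fun i => (1 + (-z) i) / 2) (negc x) =
      biasedWeight (fun i => (1 + z i) / 2) x := by
  refine Finset.prod_congr rfl fun i _ => ?_
  cases h : x i <;> simp [negc, h] <;> ring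

lemma multilinearExt_neg {n : ℕ} {X : Type*} [AddCommGroup X] [Module ℝ X]
    {g : (Fin n → Bool) → X} (hg : ∀ x, g (negc x) = -g x) (z : Fin n → ℝ) :
    multilinearExt g (-z) = -multilinearExt g z := by
  have hinv : Function.Involutive (negc : (Fin n → Bool) → Fin n → Bool) := negc_negc
  unfold multilinearExt
  rw [← Equiv.sum_comp hinv.toPerm, ← Finset.sum_neg_distrib]
  refine Finset.sum_congr rfl fun x _ => ?_
  rw [Function.Involutive.coe_toPerm, biasedWeight_neg_negc, hg, smul_neg]

lemma continuous_biasedWeight {n : ℕ} (x : Fin n → Bool) :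
    Continuous fun z : Fin n → ℝ => biasedWeight (fun i => (1 + z i) / 2) x := by
  unfold biasedWeight
  refine continuous_finsetProd _ fun i _ => ?_
  split_ifs <;> fun_prop

/-- An odd function from the cube to a `d`-dimensional space has an almost vanishing
multilinear extension at some point of the `d`-dimensional skeleton. -/
lemma exists_multilinearExt_small {X : Type*} [NormedAddCommGroup X] [NormedSpace ℝ X]
    [FiniteDimensional ℝ X] {n : ℕ} {g : (Fin n → Bool) → X} (hg : ∀ x, g (negc x) = -g x)
    {δ : ℝ} (hδ : 0 < δ) :
    ∃ z : Fin n → ℝ, (∀ i, |z i| ≤ 1) ∧ #{i | |z i| ≠ 1} ≤ min n (Module.finrank ℝ X) ∧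
      ‖multilinearExt g z‖ ≤ δ := by
  rcases le_total n (Module.finrank ℝ X) with hn | hn
  · refine ⟨0, by simp, ?_, ?_⟩
    · rw [min_eq_left hn]
      exact (Finset.card_le_univ _).trans_eq (Fintype.card_fin n)
    · have := multilinearExt_neg hg 0
      rw [neg_zero, eq_neg_iff_add_eq_zero, ← two_smul ℝ, smul_eq_zero] at this
      rw [this.resolve_left two_ne_zero, norm_zero]
      exact hδ.le
  · set d := Module.finrank ℝ X with hd
    let b := Module.finBasis ℝ X
    set C := ∑ k, ‖b k‖ with hC
    have hC0 : 0 ≤ C := Finset.sum_nonneg fun _ _ => norm_nonneg _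
    let G : ℕ → (Fin n → ℝ) → ℝ := fun k z =>
      if h : k < d then b.repr (multilinearExt g z) ⟨k, h⟩ else 0
    obtain ⟨z, hz1, hz2, hz3⟩ := exists_skeleton_small n d hn G
      (fun k => by
        simp only [G]
        split_ifs with h
        · simp only [multilinearExt, map_sum, map_smul, Finsupp.coe_finsetSum,
            Finset.sum_apply, Finsupp.smul_apply, smul_eq_mul]
          exact continuous_finsetSum _ fun x _ => (continuous_biasedWeight x).mul_const _
        · exact continuous_const)
      (fun k z => by
        simp only [G]
        split_ifs with h
        · simp [multilinearExt_neg hg]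
        · simp)
      (δ / (1 + C)) (by positivity)
    refine ⟨z, hz1, by rwa [min_eq_right hn], ?_⟩
    rw [← b.sum_repr (multilinearExt g z)]
    calc ‖∑ k, b.repr (multilinearExt g z) k • b k‖ ≤ ∑ k, δ / (1 + C) * ‖b k‖ := by
          refine norm_sum_le_of_le _ fun k _ => ?_
          rw [norm_smul, Real.norm_eq_abs]
          refine mul_le_mul_of_nonneg_right ?_ (norm_nonneg _)
          have hkd : (k : ℕ) < d := k.2
          have hGk : G k z = b.repr (multilinearExt g z) k := dif_pos hkd
          rw [← hGk]
          exact hz3 k hkd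
      _ = δ / (1 + C) * C := by rw [← Finset.mul_sum]
      _ ≤ δ := by
          rw [div_mul_eq_mul_div, div_le_iff₀ (by positivity)]
          nlinarith

/-- An odd function on the cube which is bounded below in norm has a large discrete gradient. -/
lemma norm_odd_le_of_flipc_le {p T : ℝ} (hp1 : 1 ≤ p) (hp2 : p ≤ 2) (hT : 0 < T) {X : Type*}
    [NormedAddCommGroup X] [NormedSpace ℝ X] [FiniteDimensional ℝ X]
    (hX : RademacherType X p T) {n : ℕ} {g : (Fin n → Bool) → X}
    (hg : ∀ x, g (negc x) = -g x) {R L : ℝ} (hR : 0 < R) (hL : 0 ≤ L) (hgR : ∀ x, R ≤ ‖g x‖)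
    (hgL : ∀ y i, ‖g y - g (flipc y i)‖ ≤ L) :
    R ≤ 16 * T * ((min n (Module.finrank ℝ X) : ℕ) : ℝ) ^ (1 / p) * L := by
  obtain ⟨z, hz1, hz2, hz3⟩ := exists_multilinearExt_small hg (half_pos hR)
  have hz : ∀ i, -1 ≤ z i ∧ z i ≤ 1 := fun i => abs_le.1 (hz1 i)
  set α : Fin n → ℝ := fun i => (1 + z i) / 2 with hα
  have h0 : ∀ i, 0 ≤ α i := fun i => by simp only [hα]; linarith [(hz i).1]
  have h1 : ∀ i, α i ≤ 1 := fun i => by simp only [hα]; linarith [(hz i).2]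
  have hk : #{i | α i ≠ 0 ∧ α i ≠ 1} ≤ min n (Module.finrank ℝ X) := by
    refine (Finset.card_le_card fun i hi => ?_).trans hz2
    simp only [Finset.mem_filter, Finset.mem_univ, true_and, hα] at hi ⊢
    intro habs
    rcases eq_or_eq_neg_of_abs_eq habs with h | h <;> rw [h] at hi <;> norm_num at hi
  have hmain := sum_biasedWeight_norm_sub_le hp1 hp2 hT hX h0 h1 hk hL hgL
  have hlow : R - R / 2 ≤
      ∑ x, biasedWeight α x * ‖g x - ∑ y, biasedWeight α y • g y‖ := by
    calc R - R / 2 = ∑ x, biasedWeight α x * (R - R / 2) := by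
          rw [← Finset.sum_mul, sum_biasedWeight, one_mul]
      _ ≤ _ := Finset.sum_le_sum fun x _ =>
          mul_le_mul_of_nonneg_left ((sub_le_sub (hgR x) hz3).trans (norm_sub_norm_le _ _))
            (biasedWeight_nonneg h0 h1 x)
  linarith

/-- Bi-Lipschitz distortion lower bound for embeddings of the Hamming
cube into a finite-dimensional normed space of Rademacher type `p`. -/
theorem stmt0 :
    ∃ c : ℝ, 0 < c ∧
      ∀ (p : ℝ), 1 ≤ p → p ≤ 2 →
      ∀ (X : Type) [NormedAddCommGroup X] [NormedSpace ℝ X] [FiniteDimensional ℝ X],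
      1 ≤ Module.finrank ℝ X →
      ∀ T : ℝ, 0 < T → RademacherType X p T →
      ∀ n : ℕ, 1 ≤ n →
      ∀ (f : (Fin n → Bool) → X) (s D : ℝ), 0 < s → 1 ≤ D →
      (∀ x y : Fin n → Bool,
        s * (hamming x y : ℝ) ≤ ‖f x - f y‖ ∧
          ‖f x - f y‖ ≤ s * D * (hamming x y : ℝ)) →
      c * n / (T * ((min n (Module.finrank ℝ X) : ℕ) : ℝ) ^ (1 / p)) ≤ D := by
  refine ⟨1 / 32, by norm_num, ?_⟩
  intro p hp1 hp2 X _ _ _ hd T hT hX n hn f s D hs hD hf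
  have hn0 : (0 : ℝ) < n := by exact_mod_cast hn
  have hlip : ∀ y i, ‖f y - f (flipc y i)‖ ≤ s * D := fun y i => by
    simpa [hamming_flipc] using (hf y (flipc y i)).2
  have hsD : 0 ≤ s * D := by positivity
  have h := norm_odd_le_of_flipc_le hp1 hp2 hT hX (g := fun x => f x - f (negc x))
    (fun x => by simp [negc_negc]) (R := s * n) (L := 2 * (s * D)) (by positivity)
    (by positivity) (fun x => by simpa [hamming_negc] using (hf x (negc x)).1)
    (fun y i => by
      have h1 := hlip y i
      have h2 := hlip (negc y) i
      rw [negc_flipc, sub_sub_sub_comm]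
      exact (norm_sub_le _ _).trans (by linarith))
  have hk : (0 : ℝ) < ((min n (Module.finrank ℝ X) : ℕ) : ℝ) :=
    Nat.cast_pos.2 (lt_min hn hd)
  rw [div_le_iff₀ (by positivity)]
  have h' : s * n ≤ s * (32 * (D * (T * ((min n (Module.finrank ℝ X) : ℕ) : ℝ) ^ (1 / p)))) := by
    linarith
  linarith [le_of_mul_le_mul_left h' hs]
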